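/- Let Y be a real Gaussian random variable with variance Var(Y) ≥ v > 0, let σ̃ > 0, and let ζ be a centered Gaussian random variable with variance σ̃², independent of Y. Let a, b, u ∈ ℝ with |a| < 1, set X := (1+a)·Y + b + ζ, let σ ≥ σ̃, and let α > |a·u + b|. Then E[(1_{X ≥ u} − 1_{Y ≥ u})²] ≤ Ψ(α/σ) + (1/√(2πv)) · 2α/(1+a). -/

import Mathlib

open MeasureTheory ProbabilityTheory Real

/-- The upper tail of the standard Gaussian distribution:
`gaussTail t = P(Z ≥ t)` for `Z` standard normal. -/
noncomputable def gaussTail (t : ℝ) : ℝ :=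
  ((gaussianReal 0 1) (Set.Ici t)).toReal

lemma aux_tail_upper (c : ℝ) (hc : 0 < c) (t : ℝ) :
    (gaussianReal 0 (NNReal.mk (c ^ 2) (sq_nonneg c))).real (Set.Ici t) = gaussTail (t / c) := by
  have h := gaussianReal_map_const_mul (μ := 0) (v := 1) c
  rw [mul_zero, mul_one] at h
  rw [← h, map_measureReal_apply (by fun_prop) measurableSet_Ici]
  unfold gaussTail Measure.real
  congr 2
  ext x
  simp only [Set.mem_preimage, Set.mem_Ici]
  rw [div_le_iff₀ hc, mul_comm]

lemma aux_tail_lower (c : ℝ) (hc : 0 < c) (t : ℝ) :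
    (gaussianReal 0 (NNReal.mk (c ^ 2) (sq_nonneg c))).real (Set.Iic (-t)) = gaussTail (t / c) := by
  rw [← aux_tail_upper c hc t]
  have h := gaussianReal_map_neg (μ := 0) (v := (NNReal.mk (c ^ 2) (sq_nonneg c)))
  rw [neg_zero] at h
  conv_lhs => rw [← h]
  rw [map_measureReal_apply (by fun_prop) measurableSet_Iic]
  congr 1
  ext x
  simp

lemma aux_tail_anti {s t : ℝ} (h : s ≤ t) : gaussTail t ≤ gaussTail s :=
  measureReal_mono (μ := gaussianReal 0 1) (Set.Ici_subset_Ici.mpr h)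

lemma aux_interval (m : ℝ) (s : NNReal) (v : ℝ) (hv : 0 < v) (hs : v ≤ s) (p q : ℝ) (hpq : p ≤ q) :
    (gaussianReal m s).real (Set.Icc p q) ≤ (1 / Real.sqrt (2 * π * v)) * (q - p) := by
  have hs0 : s ≠ 0 := by
    rintro rfl
    simp at hs
    linarith
  unfold Measure.real
  rw [gaussianReal_apply_eq_integral m hs0,
    ENNReal.toReal_ofReal (integral_nonneg fun x => gaussianPDFReal_nonneg _ _ _)]
  have hb : ∀ x, gaussianPDFReal m s x ≤ 1 / Real.sqrt (2 * π * v) := by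
    intro x
    rw [gaussianPDFReal_def]
    have h1 : rexp (-(x - m) ^ 2 / (2 * s)) ≤ 1 := by
      rw [Real.exp_le_one_iff]
      apply div_nonpos_of_nonpos_of_nonneg
      · linarith [sq_nonneg (x - m)]
      · positivity
    have h2 : (Real.sqrt (2 * π * s))⁻¹ ≤ 1 / Real.sqrt (2 * π * v) := by
      rw [← one_div]
      have := Real.pi_pos
      apply one_div_le_one_div_of_le
      · positivity
      · apply Real.sqrt_le_sqrt
        gcongr
    calc _ ≤ (Real.sqrt (2 * π * s))⁻¹ * 1 :=
          mul_le_mul_of_nonneg_left h1 (by positivity)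
      _ ≤ _ := by linarith
  calc _ ≤ ∫ x in Set.Icc p q, (1 / Real.sqrt (2 * π * v)) := by
        apply setIntegral_mono
        · exact (integrable_gaussianPDFReal m s).integrableOn
        · exact integrableOn_const (by simp)
        · exact hb
    _ = _ := by
        rw [setIntegral_const, smul_eq_mul, Real.volume_real_Icc_of_le hpq, mul_comm]

/-- Inequality (11) of the paper: for `Y` Gaussian with `Var(Y) ≥ v > 0`,
`ζ ∼ N(0, σ̃²)` independent of `Y`, `X = (1+a)·Y + b + ζ`, `|a| < 1`, `σ ≥ σ̃`
and `α > |a·u + b|`,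
`E[(1_{X ≥ u} − 1_{Y ≥ u})²] ≤ Ψ(α/σ) + (1/√(2πv))·2α/(1+a)`. -/
theorem expectation_indicator_diff_sq_bound
    {Ω : Type*} [MeasurableSpace Ω] (P : Measure Ω) [IsProbabilityMeasure P]
    (Y ζ : Ω → ℝ) (hYmeas : Measurable Y) (hζmeas : Measurable ζ)
    (hYgauss : ∃ (m : ℝ) (s : NNReal), Measure.map Y P = gaussianReal m s)
    (v : ℝ) (hv : 0 < v) (hvar : v ≤ variance Y P)
    (σt : ℝ) (hσt : 0 < σt)
    (hζlaw : Measure.map ζ P = gaussianReal 0 ⟨σt ^ 2, sq_nonneg σt⟩)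
    (hindep : IndepFun Y ζ P)
    (a b u : ℝ) (ha : |a| < 1)
    (σ : ℝ) (hσ : σt ≤ σ)
    (α : ℝ) (hα : |a * u + b| < α) :
    (∫ ω, ((if u ≤ (1 + a) * Y ω + b + ζ ω then (1 : ℝ) else 0)
          - (if u ≤ Y ω then (1 : ℝ) else 0)) ^ 2 ∂P)
      ≤ gaussTail (α / σ) + (1 / Real.sqrt (2 * π * v)) * (2 * α / (1 + a)) := by
  have hζlaw : Measure.map ζ P = gaussianReal 0 (NNReal.mk (σt ^ 2) (sq_nonneg σt)) := hζlaw
  obtain ⟨m, s, hY⟩ := hYgauss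
  have hvs : v ≤ s := by
    have : variance Y P = s := by
      rw [← variance_id_gaussianReal (μ := m) (v := s), ← hY,
        variance_map aemeasurable_id hYmeas.aemeasurable]
      rfl
    rwa [this] at hvar
  have ha1 : 0 < 1 + a := by linarith [(abs_lt.mp ha).1]
  obtain ⟨hα1, hα2⟩ := abs_lt.mp hα
  have hα0 : 0 < α := lt_of_le_of_lt (abs_nonneg _) hα
  set p := (u - b - α) / (1 + a) with hp
  set q := (u - b + α) / (1 + a) with hq
  have hp' : (1 + a) * p = u - b - α := by rw [hp]; field_simp
  have hq' : (1 + a) * q = u - b + α := by rw [hq]; field_simp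
  have hqp : q - p = 2 * α / (1 + a) := by rw [hp, hq]; field_simp; ring
  have hpu : p < u := by
    by_contra! h
    nlinarith
  have huq : u < q := by
    by_contra! h
    nlinarith
  set A := Y ⁻¹' Set.Icc p q with hA
  set B := Y ⁻¹' Set.Ioi q ∩ ζ ⁻¹' Set.Iic (-α) with hB
  set C := Y ⁻¹' Set.Iio p ∩ ζ ⁻¹' Set.Ici α with hC
  have mA : MeasurableSet A := hYmeas measurableSet_Icc
  have mB : MeasurableSet B := (hYmeas measurableSet_Ioi).inter (hζmeas measurableSet_Iic)
  have mC : MeasurableSet C := (hYmeas measurableSet_Iio).inter (hζmeas measurableSet_Ici)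
  have h1 : (∫ ω, ((if u ≤ (1 + a) * Y ω + b + ζ ω then (1 : ℝ) else 0)
          - (if u ≤ Y ω then (1 : ℝ) else 0)) ^ 2 ∂P) ≤ P.real (A ∪ (B ∪ C)) := by
    rw [← integral_indicator_one (mA.union (mB.union mC))]
    apply integral_mono_of_nonneg
    · exact Filter.Eventually.of_forall fun ω => sq_nonneg _
    · exact (integrable_const (1 : ℝ)).indicator (mA.union (mB.union mC))
    · refine Filter.Eventually.of_forall fun ω => ?_
      by_cases hω : ω ∈ A ∪ (B ∪ C)
      · simp only [Set.indicator_of_mem hω, Pi.one_apply]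
        split_ifs <;> norm_num
      · simp only [Set.indicator_of_notMem hω]
        simp only [hA, hB, hC, Set.mem_union, Set.mem_inter_iff, Set.mem_preimage, Set.mem_Icc,
          Set.mem_Ioi, Set.mem_Iio, Set.mem_Iic, Set.mem_Ici, not_or, not_and, not_le] at hω
        obtain ⟨w1, w2, w3⟩ := hω
        rcases lt_or_ge (Y ω) p with h | h
        · have := w3 h
          rw [if_neg (by nlinarith), if_neg (by linarith)]
          norm_num
        · have hq1 := w1 h
          have := w2 hq1
          rw [if_pos (by nlinarith), if_pos (by linarith)]
          norm_num
  have hAb : P.real A ≤ (1 / Real.sqrt (2 * π * v)) * (2 * α / (1 + a)) := by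
    rw [hA, ← map_measureReal_apply hYmeas measurableSet_Icc, hY, ← hqp]
    exact aux_interval m s v hv hvs p q (by linarith)
  have hBb : P.real B = P.real (Y ⁻¹' Set.Ioi q) * gaussTail (α / σt) := by
    rw [← aux_tail_lower σt hσt α, ← hζlaw, map_measureReal_apply hζmeas measurableSet_Iic]
    unfold Measure.real
    rw [hB, hindep.measure_inter_preimage_eq_mul _ _ measurableSet_Ioi measurableSet_Iic,
      ENNReal.toReal_mul]
  have hCb : P.real C = P.real (Y ⁻¹' Set.Iio p) * gaussTail (α / σt) := by
    rw [← aux_tail_upper σt hσt α, ← hζlaw, map_measureReal_apply hζmeas measurableSet_Ici]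
    unfold Measure.real
    rw [hC, hindep.measure_inter_preimage_eq_mul _ _ measurableSet_Iio measurableSet_Ici,
      ENNReal.toReal_mul]
  have hsum : P.real (Y ⁻¹' Set.Ioi q) + P.real (Y ⁻¹' Set.Iio p) ≤ 1 := by
    rw [← measureReal_union _ (hYmeas measurableSet_Iio)]
    · exact measureReal_le_one
    · apply Disjoint.preimage
      rw [Set.disjoint_left]
      intro x hx hx'
      simp only [Set.mem_Ioi, Set.mem_Iio] at hx hx'
      linarith
  have hT0 : 0 ≤ gaussTail (α / σt) := ENNReal.toReal_nonneg
  have hT : gaussTail (α / σt) ≤ gaussTail (α / σ) := aux_tail_anti (by gcongr)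
  have hU1 := measureReal_union_le (μ := P) A (B ∪ C)
  have hU2 := measureReal_union_le (μ := P) B C
  nlinarith [mul_le_mul_of_nonneg_right hsum hT0]
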